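/- Let A ⊆ ∂ be closed in the subspace topology of ∂ and define h : S → [0,1] by h(x) := 𝐏_x(X_∞ ∈ A). Then almost surely the limit lim_{n→∞} ⟨h, B̄_n⟩ exists, and every subsequential weak limit W of the sequence of random finite measures (B̄_n)_{n≥0} on C satisfies W(A) = lim_{n→∞} ⟨h, B̄_n⟩. -/

import Mathlib

open MeasureTheory Filter Topology

/-- The (rescaled) branching random walk configuration `w : S → ℝ≥0∞`, viewed as a finite
measure on the compactification `C` via the embedding `ι`: the measure `∑ₓ w(x) δ_{ι(x)}`. -/
noncomputable def brwMeasure {S C : Type*} [MeasurableSpace C] (ι : S → C) (w : S → ENNReal) :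
    MeasureTheory.Measure C :=
  MeasureTheory.Measure.sum fun x => w x • MeasureTheory.Measure.dirac (ι x)

/-- `W` is a subsequential weak limit of the sequence of finite measures `μs` on `C`:
along some strictly increasing subsequence, the integrals of every bounded continuous
function converge to the corresponding integral against `W`. -/
def IsSubseqWeakLimit {C : Type*} [TopologicalSpace C] [MeasurableSpace C]
    (μs : ℕ → MeasureTheory.Measure C) (W : MeasureTheory.Measure C) : Prop :=
  ∃ φ : ℕ → ℕ, StrictMono φ ∧
    ∀ f : BoundedContinuousFunction C ℝ,
      Filter.Tendsto (fun k => ∫ c, f c ∂(μs (φ k))) Filter.atTop (nhds (∫ c, f c ∂W))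

open Preorder
open scoped ENNReal

/-- The trajectories which agree with `s` up to time `n`. -/
def pathCylinder {S : Type*} (n : ℕ) (s : ℕ → S) : Set (ℕ → S) := {ω | ∀ i ≤ n, ω i = s i}

/-- The family `Q` of trajectory measures gives cylinders the mass prescribed by the
transition weights `p`. -/
structure IsMarkovChainLaw {S : Type*} [MeasurableSpace S] (p : S → S → ℝ≥0∞)
    (Q : S → Measure (ℕ → S)) : Prop where
  isProbabilityMeasure : ∀ x, IsProbabilityMeasure (Q x)
  cylinder_self : ∀ n (s : ℕ → S),
    Q (s 0) (pathCylinder n s) = ∏ i ∈ Finset.range n, p (s i) (s (i + 1))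
  cylinder_of_ne : ∀ x n (s : ℕ → S), s 0 ≠ x → Q x (pathCylinder n s) = 0

/-- The time shift on trajectories. -/
def pathShift {S : Type*} (n : ℕ) (ω : ℕ → S) : ℕ → S := fun i => ω (n + i)

section Cylinder

variable {S : Type*}

lemma pathCylinder_eq_preimage (n : ℕ) (s : ℕ → S) :
    pathCylinder n s = restrictLe (π := fun _ => S) n ⁻¹' {restrictLe n s} := by
  ext ω
  simp only [pathCylinder, Set.mem_ofPred_eq, Set.mem_preimage, Set.mem_singleton_iff, funext_iff,
    restrictLe_apply, Subtype.forall, Set.mem_Iic]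

lemma restrictLe_surjective (n : ℕ) :
    Function.Surjective (restrictLe (π := fun _ : ℕ => S) n) := by
  intro q
  refine ⟨fun i => if h : i ≤ n then q ⟨i, h⟩ else q ⟨0, Nat.zero_le n⟩, ?_⟩
  ext ⟨i, hi⟩
  simp [Set.mem_Iic.1 hi]

lemma pathCylinder_congr {n : ℕ} {s ω : ℕ → S} (h : ω ∈ pathCylinder n s) :
    pathCylinder n s = pathCylinder n ω := by
  ext η
  simp only [pathCylinder, Set.mem_ofPred_eq] at h ⊢
  exact forall₂_congr fun i hi => by rw [h i hi]

lemma pathCylinder_inter (n k : ℕ) (ω : ℕ → S) :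
    pathCylinder n ω ∩ pathCylinder k ω = pathCylinder (max n k) ω := by
  ext η
  simp only [pathCylinder, Set.mem_inter_iff, Set.mem_ofPred_eq, le_max_iff]
  exact ⟨fun h i hi => hi.elim (h.1 i) (h.2 i),
    fun h => ⟨fun i hi => h i (.inl hi), fun i hi => h i (.inr hi)⟩⟩

lemma isPiSystem_pathCylinder :
    IsPiSystem {T : Set (ℕ → S) | ∃ n s, T = pathCylinder n s} := by
  rintro _ ⟨n, s, rfl⟩ _ ⟨k, t, rfl⟩ ⟨ω, h1, h2⟩
  exact ⟨max n k, ω, by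
    rw [pathCylinder_congr h1, pathCylinder_congr h2, pathCylinder_inter]⟩

/-- Prescribing `s` up to time `n` and `t` from time `n` on amounts to prescribing the
concatenation of `s` and `t`. -/
lemma pathCylinder_inter_preimage_pathShift (n k : ℕ) (s t : ℕ → S) (h : t 0 = s n) :
    pathCylinder n s ∩ pathShift n ⁻¹' pathCylinder k t =
      pathCylinder (n + k) (fun i => if i < n then s i else t (i - n)) := by
  ext ω
  simp only [pathCylinder, pathShift, Set.mem_inter_iff, Set.mem_ofPred_eq, Set.mem_preimage]
  constructor
  · rintro ⟨h1, h2⟩ i hi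
    split_ifs with hin
    · exact h1 i hin.le
    · have := h2 (i - n) (by omega)
      rwa [Nat.add_sub_cancel' (not_lt.1 hin)] at this
  · intro H
    refine ⟨fun i hi => ?_, fun i hi => ?_⟩
    · rcases hi.lt_or_eq with hlt | rfl
      · simpa [hlt] using H i (by omega)
      · simpa [h] using H i (by omega)
    · simpa using H (n + i) (by omega)

variable [MeasurableSpace S]

@[fun_prop]
lemma measurable_pathShift (n : ℕ) : Measurable (pathShift (S := S) n) :=
  measurable_pi_lambda _ fun i => measurable_pi_apply (n + i)

variable [MeasurableSingletonClass S]

lemma measurableSet_pathCylinder (n : ℕ) (s : ℕ → S) : MeasurableSet (pathCylinder n s) := by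
  rw [pathCylinder_eq_preimage]
  exact measurable_restrictLe n (measurableSet_singleton _)

variable [Countable S]

lemma pi_eq_generateFrom_pathCylinder :
    (MeasurableSpace.pi : MeasurableSpace (ℕ → S)) =
      MeasurableSpace.generateFrom {T | ∃ n s, T = pathCylinder n s} := by
  apply le_antisymm
  · refine iSup_le fun n => ?_
    rw [← measurable_iff_comap_le]
    refine @measurable_to_countable' _ _ _ _
      (MeasurableSpace.generateFrom {T | ∃ n s, T = pathCylinder n s}) _ fun a => ?_
    have : (fun ω : ℕ → S => ω n) ⁻¹' {a} =
        ⋃ q ∈ {q : Set.Iic n → S | q ⟨n, Set.mem_Iic.2 le_rfl⟩ = a},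
          restrictLe (π := fun _ => S) n ⁻¹' {q} := by
      ext ω
      simp
    rw [this]
    refine @MeasurableSet.biUnion _ _ (MeasurableSpace.generateFrom _) _ _ (Set.to_countable _)
      fun q _ => ?_
    obtain ⟨s, rfl⟩ := restrictLe_surjective n q
    exact MeasurableSpace.measurableSet_generateFrom ⟨n, s, (pathCylinder_eq_preimage n s).symm⟩
  · refine MeasurableSpace.generateFrom_le ?_
    rintro _ ⟨n, s, rfl⟩
    exact measurableSet_pathCylinder n s

end Cylinder

namespace IsMarkovChainLaw

variable {S : Type*} [MeasurableSpace S] {p : S → S → ℝ≥0∞} {Q : S → Measure (ℕ → S)}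

lemma cylinder_concat (hQ : IsMarkovChainLaw p Q) (x : S) (n k : ℕ) (s t : ℕ → S) :
    Q x (pathCylinder n s ∩ pathShift n ⁻¹' pathCylinder k t) =
      Q x (pathCylinder n s) * Q (s n) (pathCylinder k t) := by
  by_cases h : t 0 = s n
  swap
  · rw [hQ.cylinder_of_ne _ _ _ h, mul_zero]
    convert measure_empty (μ := Q x)
    ext ω
    simp only [Set.mem_inter_iff, Set.mem_preimage, Set.mem_empty_iff_false, iff_false, not_and]
    intro h1 h2
    exact h ((h2 0 (Nat.zero_le _)).symm.trans (h1 n le_rfl))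
  rw [pathCylinder_inter_preimage_pathShift n k s t h, ← h, hQ.cylinder_self k t]
  set r : ℕ → S := fun i => if i < n then s i else t (i - n) with hr
  have hrs : ∀ i ≤ n, r i = s i := by
    intro i hi
    rcases hi.lt_or_eq with hlt | rfl
    · simp [hr, hlt]
    · simp [hr, h]
  have hrt : ∀ i, r (n + i) = t i := fun i => by simp [hr]
  by_cases hx : s 0 = x
  swap
  · rw [hQ.cylinder_of_ne _ _ _ hx, hQ.cylinder_of_ne _ _ r (by rwa [hrs 0 (Nat.zero_le _)]),
      zero_mul]
  subst hx
  rw [hQ.cylinder_self, ← hrs 0 (Nat.zero_le _), hQ.cylinder_self, Finset.prod_range_add]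
  congr 1
  · refine Finset.prod_congr rfl fun i hi => ?_
    have := Finset.mem_range.1 hi
    rw [hrs i this.le, hrs (i + 1) this]
  · refine Finset.prod_congr rfl fun i _ => ?_
    rw [hrt, add_assoc, hrt]

variable [MeasurableSingletonClass S]

lemma ae_zero (hQ : IsMarkovChainLaw p Q) (x : S) : ∀ᵐ ω ∂Q x, ω 0 = x := by
  have := hQ.isProbabilityMeasure x
  have h1 : Q x (pathCylinder 0 fun _ => x) = 1 := by
    simpa using hQ.cylinder_self 0 (fun _ => x)
  rw [← mem_ae_iff_prob_eq_one (measurableSet_pathCylinder _ _)] at h1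
  filter_upwards [h1] with ω hω using hω 0 le_rfl

lemma map_eval_one (hQ : IsMarkovChainLaw p Q) (x y : S) :
    Q x ((fun ω => ω 1) ⁻¹' {y}) = p x y := by
  have h := hQ.cylinder_self 1 (fun i => if i = 0 then x else y)
  simp only [Finset.range_one, Finset.prod_singleton, if_true, zero_add, one_ne_zero,
    if_false] at h
  rw [← h]
  refine measure_congr ?_
  filter_upwards [hQ.ae_zero x] with ω hω
  refine propext ⟨fun h1 i hi => ?_, fun h => ?_⟩
  · interval_cases i
    · simpa using hω
    · exact h1
  · exact h 1 le_rfl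

variable [Countable S]

lemma restrict_map_pathShift (hQ : IsMarkovChainLaw p Q) (x : S) (n : ℕ) (s : ℕ → S) :
    ((Q x).restrict (pathCylinder n s)).map (pathShift n) =
      Q x (pathCylinder n s) • Q (s n) := by
  have := hQ.isProbabilityMeasure
  refine ext_of_generate_finite _ pi_eq_generateFrom_pathCylinder isPiSystem_pathCylinder ?_ ?_
  · rintro _ ⟨k, t, rfl⟩
    rw [Measure.map_apply (measurable_pathShift n) (measurableSet_pathCylinder _ _),
      Measure.restrict_apply (measurable_pathShift n (measurableSet_pathCylinder _ _)),
      Set.inter_comm, hQ.cylinder_concat]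
    simp
  · rw [Measure.map_apply (measurable_pathShift n) MeasurableSet.univ]
    simp

/-- The Markov property at a fixed time, integrated over an event of the past. -/
lemma setLIntegral_comp_pathShift (hQ : IsMarkovChainLaw p Q) (x : S) (n : ℕ)
    {G : (ℕ → S) → ℝ≥0∞} (hG : Measurable G) (T : Set (Set.Iic n → S)) :
    ∫⁻ ω in restrictLe (π := fun _ => S) n ⁻¹' T, G (pathShift n ω) ∂Q x =
      ∫⁻ ω in restrictLe (π := fun _ => S) n ⁻¹' T, ∫⁻ η, G η ∂Q (ω n) ∂Q x := by
  have hT : restrictLe (π := fun _ : ℕ => S) n ⁻¹' T =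
      ⋃ q ∈ T, restrictLe (π := fun _ => S) n ⁻¹' {q} := by
    rw [← Set.preimage_iUnion₂, Set.biUnion_of_singleton]
  have hd : T.PairwiseDisjoint fun q => restrictLe (π := fun _ : ℕ => S) n ⁻¹' {q} := by
    intro q _ q' _ hne
    exact Disjoint.preimage _ (by simpa using hne)
  have hm : ∀ q ∈ T, MeasurableSet (restrictLe (π := fun _ : ℕ => S) n ⁻¹' {q}) :=
    fun q _ => measurable_restrictLe n (measurableSet_singleton _)
  rw [hT, lintegral_biUnion T.to_countable hm hd, lintegral_biUnion T.to_countable hm hd]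
  refine tsum_congr fun q => ?_
  obtain ⟨s, hs⟩ := restrictLe_surjective n q.1
  rw [← hs, ← pathCylinder_eq_preimage]
  rw [← lintegral_map hG (measurable_pathShift n), hQ.restrict_map_pathShift,
    lintegral_smul_measure]
  have : ∫⁻ ω in pathCylinder n s, ∫⁻ η, G η ∂Q (ω n) ∂Q x =
      ∫⁻ _ in pathCylinder n s, ∫⁻ η, G η ∂Q (s n) ∂Q x :=
    setLIntegral_congr_fun (measurableSet_pathCylinder _ _) fun ω hω => by
      simp only [hω n le_rfl]
  rw [this, setLIntegral_const, smul_eq_mul, mul_comm]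

lemma lintegral_comp_pathShift (hQ : IsMarkovChainLaw p Q) (x : S) (n : ℕ)
    {G : (ℕ → S) → ℝ≥0∞} (hG : Measurable G) :
    ∫⁻ ω, G (pathShift n ω) ∂Q x = ∫⁻ ω, ∫⁻ η, G η ∂Q (ω n) ∂Q x := by
  simpa using hQ.setLIntegral_comp_pathShift x n hG Set.univ

lemma ae_comp_pathShift (hQ : IsMarkovChainLaw p Q) {q : (ℕ → S) → Prop}
    (h : ∀ y, ∀ᵐ ω ∂Q y, q ω) (x : S) (n : ℕ) : ∀ᵐ ω ∂Q x, q (pathShift n ω) := by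
  have hnull : ∀ y, Q y {ω | ¬ q ω} = 0 := fun y => ae_iff.1 (h y)
  obtain ⟨N, hN, hNm, hN0⟩ : ∃ N : Set (ℕ → S), {ω | ¬ q ω} ⊆ N ∧ MeasurableSet N ∧
      ∀ y, Q y N = 0 :=
    ⟨⋂ y, toMeasurable (Q y) {ω | ¬ q ω}, Set.subset_iInter fun y => subset_toMeasurable _ _,
      MeasurableSet.iInter fun y => measurableSet_toMeasurable _ _, fun y =>
        measure_mono_null (Set.iInter_subset _ y) (by rw [measure_toMeasurable, hnull])⟩
  have key := hQ.lintegral_comp_pathShift x n (measurable_const.indicator hNm : Measurable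
    (N.indicator fun _ => (1 : ℝ≥0∞)))
  simp only [lintegral_indicator_const hNm, hN0, mul_zero, lintegral_zero] at key
  rw [lintegral_eq_zero_iff (by fun_prop)] at key
  filter_upwards [key] with ω hω
  by_contra hq
  have : pathShift n ω ∈ N := hN hq
  simp [this] at hω

lemma lintegral_eval_one (hQ : IsMarkovChainLaw p Q) (x : S) (g : S → ℝ≥0∞) :
    ∫⁻ ω, g (ω 1) ∂Q x = ∑' y, p x y * g y := by
  rw [← lintegral_map (measurable_of_countable g) (measurable_pi_apply 1),
    lintegral_countable']
  refine tsum_congr fun y => ?_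
  rw [Measure.map_apply (measurable_pi_apply 1) (measurableSet_singleton y), mul_comm]
  rw [hQ.map_eval_one]

/-- First-step analysis. -/
lemma tsum_mul_lintegral (hQ : IsMarkovChainLaw p Q) (x : S)
    {G : (ℕ → S) → ℝ≥0∞} (hG : Measurable G) :
    ∑' y, p x y * ∫⁻ ω, G ω ∂Q y = ∫⁻ ω, G (pathShift 1 ω) ∂Q x := by
  rw [hQ.lintegral_comp_pathShift x 1 hG, hQ.lintegral_eval_one x fun y => ∫⁻ ω, G ω ∂Q y]

lemma iSup_piLE : (⨆ n, Filtration.piLE (X := fun _ : ℕ => S) n) = MeasurableSpace.pi := by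
  refine le_antisymm (iSup_le fun n => Filtration.piLE.le n) (iSup_le fun n => ?_)
  refine le_trans ?_ (le_iSup _ n)
  rw [← measurable_iff_comap_le]
  change Measurable[Filtration.piLE (X := fun _ : ℕ => S) n]
    ((fun q : Set.Iic n → S => q ⟨n, Set.mem_Iic.2 le_rfl⟩) ∘ restrictLe (π := fun _ => S) n)
  exact (measurable_of_countable _).comp (comap_measurable _)

/-- Lévy's upward theorem for shift-invariant functionals of the chain. -/
lemma tendsto_lintegral_of_shift_invariant (hQ : IsMarkovChainLaw p Q)
    {G : (ℕ → S) → ℝ≥0∞} (hG : Measurable G) (hG1 : ∀ ω, G ω ≤ 1)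
    (hinv : ∀ x n, ∀ᵐ ω ∂Q x, G (pathShift n ω) = G ω) (x : S) :
    ∀ᵐ ω ∂Q x, Tendsto (fun n => ∫⁻ η, G η ∂Q (ω n)) atTop (𝓝 (G ω)) := by
  have := hQ.isProbabilityMeasure
  have hu1 : ∀ y, ∫⁻ η, G η ∂Q y ≤ 1 := fun y =>
    (lintegral_mono hG1).trans (by simp)
  have hreal : ∀ a : ℝ≥0∞, a ≤ 1 → ‖a.toReal‖ ≤ 1 := fun a ha => by
    rw [Real.norm_of_nonneg ENNReal.toReal_nonneg]
    exact ENNReal.toReal_mono ENNReal.one_ne_top ha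
  have hGint : Integrable (fun ω => (G ω).toReal) (Q x) :=
    Integrable.of_bound hG.ennreal_toReal.aestronglyMeasurable 1
      (.of_forall fun ω => hreal _ (hG1 ω))
  have hum : ∀ n, Measurable[Filtration.piLE (X := fun _ : ℕ => S) n]
      fun ω : ℕ → S => ∫⁻ η, G η ∂Q (ω n) := by
    intro n
    change Measurable[Filtration.piLE (X := fun _ : ℕ => S) n]
      ((fun q : Set.Iic n → S => ∫⁻ η, G η ∂Q (q ⟨n, Set.mem_Iic.2 le_rfl⟩)) ∘
        restrictLe (π := fun _ => S) n)
    exact (measurable_of_countable _).comp (comap_measurable _)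
  have hum' : ∀ n, Measurable fun ω : ℕ → S => ∫⁻ η, G η ∂Q (ω n) := fun n =>
    (hum n).mono (Filtration.piLE.le n) le_rfl
  have hcond : ∀ n, (fun ω : ℕ → S => (∫⁻ η, G η ∂Q (ω n)).toReal) =ᵐ[Q x]
      (Q x)[fun ω => (G ω).toReal | Filtration.piLE (X := fun _ : ℕ => S) n] := by
    intro n
    have hui : Integrable (fun ω : ℕ → S => (∫⁻ η, G η ∂Q (ω n)).toReal) (Q x) :=
      Integrable.of_bound (hum' n).ennreal_toReal.aestronglyMeasurable 1
        (.of_forall fun ω => hreal _ (hu1 _))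
    refine ae_eq_condExp_of_forall_setIntegral_eq (Filtration.piLE.le n) hGint
      (fun _ _ _ => hui.integrableOn) ?_
      (hum n).ennreal_toReal.stronglyMeasurable.aestronglyMeasurable
    rintro _ ⟨T, -, rfl⟩ -
    rw [integral_toReal (hum' n).aemeasurable
        (.of_forall fun ω => (hu1 _).trans_lt ENNReal.one_lt_top),
      integral_toReal hG.aemeasurable (.of_forall fun ω => (hG1 _).trans_lt ENNReal.one_lt_top),
      ← hQ.setLIntegral_comp_pathShift x n hG T]
    congr 1
    exact lintegral_congr_ae (ae_restrict_of_ae (hinv x n))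
  have hlim := tendsto_ae_condExp (μ := Q x) (ℱ := Filtration.piLE (X := fun _ : ℕ => S))
    (fun ω => (G ω).toReal)
  rw [iSup_piLE, condExp_of_stronglyMeasurable le_rfl hG.ennreal_toReal.stronglyMeasurable
    hGint] at hlim
  filter_upwards [hlim, ae_all_iff.2 hcond] with ω h1 h2
  simp only [← h2] at h1
  exact (ENNReal.tendsto_toReal_iff (fun n => ((hu1 _).trans_lt ENNReal.one_lt_top).ne)
    ((hG1 ω).trans_lt ENNReal.one_lt_top).ne).1 h1

end IsMarkovChainLaw

/-- A branching random walk with mean offspring `m` driven by `P` and started at `o`. -/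
structure IsBranchingRandomWalk {S Ω : Type*} [DecidableEq S] {mΩ : MeasurableSpace Ω}
    (P : S → S → ℝ) (m : ℝ) (o : S) (μ : Measure Ω) (F : Filtration ℕ mΩ)
    (B : ℕ → Ω → S → ℕ) : Prop where
  adapted : ∀ n x, Measurable[F n] (fun ω => B n ω x)
  finite_support : ∀ n ω, (Function.support (B n ω)).Finite
  integrable : ∀ n x, Integrable (fun ω => (B n ω x : ℝ)) μ
  zero : ∀ ω x, B 0 ω x = if x = o then 1 else 0
  condExp_succ : ∀ n x, μ[fun ω => (B (n + 1) ω x : ℝ)|F n]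
    =ᵐ[μ] fun ω => m * ∑' y, (B n ω y : ℝ) * P y x

/-- The pairing of a function `g` with the rescaled configuration `m⁻ⁿ Bₙ`. -/
noncomputable def brwPairing {S Ω : Type*} (m : ℝ) (B : ℕ → Ω → S → ℕ) (g : S → ℝ≥0∞)
    (n : ℕ) (ω : Ω) : ℝ≥0∞ :=
  ∑' x, ENNReal.ofReal ((m ^ n)⁻¹ * (B n ω x : ℝ)) * g x

lemma brwPairing_mono {S Ω : Type*} (m : ℝ) (B : ℕ → Ω → S → ℕ) {g g' : S → ℝ≥0∞}
    (h : ∀ x, g x ≤ g' x) (n : ℕ) (ω : Ω) : brwPairing m B g n ω ≤ brwPairing m B g' n ω :=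
  ENNReal.tsum_le_tsum fun x => mul_le_mul_right (h x) _

lemma brwPairing_add {S Ω : Type*} (m : ℝ) (B : ℕ → Ω → S → ℕ) (g g' : S → ℝ≥0∞)
    (n : ℕ) (ω : Ω) :
    brwPairing m B (fun x => g x + g' x) n ω = brwPairing m B g n ω + brwPairing m B g' n ω := by
  simp only [brwPairing, mul_add, ENNReal.tsum_add]

lemma toReal_brwPairing {S Ω : Type*} {m : ℝ} (hm : 0 < m) (B : ℕ → Ω → S → ℕ)
    {g : S → ℝ≥0∞}
    (hg : ∀ x, g x ≤ 1) (n : ℕ) (ω : Ω) :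
    (brwPairing m B g n ω).toReal = (m ^ n)⁻¹ * ∑' x, (g x).toReal * (B n ω x : ℝ) := by
  rw [brwPairing, ENNReal.tsum_toReal_eq fun x => ENNReal.mul_ne_top ENNReal.ofReal_ne_top
      ((hg x).trans_lt ENNReal.one_lt_top).ne, ← tsum_mul_left]
  refine tsum_congr fun x => ?_
  rw [ENNReal.toReal_mul, ENNReal.toReal_ofReal (by positivity)]
  ring

lemma measurable_brwPairing {S Ω : Type*} [Countable S] [MeasurableSpace Ω] (m : ℝ)
    {B : ℕ → Ω → S → ℕ} (g : S → ℝ≥0∞) {n : ℕ} (hB : ∀ x, Measurable fun ω => B n ω x) :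
    Measurable (brwPairing m B g n) := by
  refine Measurable.tsum fun x => Measurable.mul_const ?_ _
  exact ENNReal.measurable_ofReal.comp
    (((measurable_of_countable (fun k : ℕ => (k : ℝ))).comp (hB x)).const_mul _)

namespace IsBranchingRandomWalk

variable {S Ω : Type*} [DecidableEq S] {mΩ : MeasurableSpace Ω} {P : S → S → ℝ} {m : ℝ} {o : S}
  {μ : Measure Ω} {F : Filtration ℕ mΩ} {B : ℕ → Ω → S → ℕ}

lemma brwPairing_zero (hB : IsBranchingRandomWalk P m o μ F B) (g : S → ℝ≥0∞) (ω : Ω) :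
    brwPairing m B g 0 ω = g o := by
  rw [brwPairing, tsum_eq_single o]
  · simp [hB.zero]
  · intro x hx
    simp [hB.zero, hx]

lemma brwPairing_ne_top (hB : IsBranchingRandomWalk P m o μ F B) {g : S → ℝ≥0∞}
    (hg : ∀ x, g x ≤ 1) (n : ℕ) (ω : Ω) : brwPairing m B g n ω ≠ ∞ := by
  rw [brwPairing, tsum_eq_sum (s := (hB.finite_support n ω).toFinset)]
  · exact ENNReal.sum_ne_top.2 fun x _ => ENNReal.mul_ne_top ENNReal.ofReal_ne_top
      ((hg x).trans_lt ENNReal.one_lt_top).ne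
  · intro x hx
    simp only [Set.Finite.mem_toFinset, Function.mem_support, not_not] at hx
    simp [hx]

lemma setLIntegral_weight_succ [IsProbabilityMeasure μ]
    (hB : IsBranchingRandomWalk P m o μ F B) (hm : 0 < m)
    (hP : ∀ x y, 0 ≤ P x y) (n : ℕ) (x : S) {T : Set Ω} (hT : MeasurableSet[F n] T) :
    ∫⁻ ω in T, ENNReal.ofReal ((m ^ (n + 1))⁻¹ * (B (n + 1) ω x : ℝ)) ∂μ =
      ∫⁻ ω in T, ∑' y, ENNReal.ofReal ((m ^ n)⁻¹ * (B n ω y : ℝ)) *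
        ENNReal.ofReal (P y x) ∂μ := by
  have hmeas : Measurable fun ω => (B (n + 1) ω x : ℝ) :=
    (measurable_of_countable (fun k : ℕ => (k : ℝ))).comp
      ((hB.adapted (n + 1) x).mono (F.le _) le_rfl)
  have hi : Integrable (fun ω => m * ∑' y, (B n ω y : ℝ) * P y x) μ :=
    integrable_condExp.congr (hB.condExp_succ n x)
  have h0 : ∀ ω, 0 ≤ m * ∑' y, (B n ω y : ℝ) * P y x := fun ω =>
    mul_nonneg hm.le (tsum_nonneg fun y => mul_nonneg (Nat.cast_nonneg _) (hP _ _))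
  have hsum : ∀ ω, Summable fun y => (B n ω y : ℝ) * P y x := fun ω =>
    summable_of_hasFiniteSupport ((hB.finite_support n ω).subset fun y hy => by
      simp only [Function.mem_support] at hy ⊢
      exact fun h => hy (by simp [h]))
  have hint : ∫ ω in T, (B (n + 1) ω x : ℝ) ∂μ =
      ∫ ω in T, m * ∑' y, (B n ω y : ℝ) * P y x ∂μ := by
    rw [← setIntegral_condExp (F.le n) (hB.integrable (n + 1) x) hT]
    exact integral_congr_ae (ae_restrict_of_ae (hB.condExp_succ n x))
  have hr : 0 ≤ (m ^ (n + 1))⁻¹ := by positivity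
  calc
    _ = ENNReal.ofReal (m ^ (n + 1))⁻¹ * ∫⁻ ω in T, ENNReal.ofReal (B (n + 1) ω x : ℝ) ∂μ := by
      rw [← lintegral_const_mul _ hmeas.ennreal_ofReal]
      simp only [ENNReal.ofReal_mul hr]
    _ = ENNReal.ofReal (m ^ (n + 1))⁻¹ *
        ∫⁻ ω in T, ENNReal.ofReal (m * ∑' y, (B n ω y : ℝ) * P y x) ∂μ := by
      rw [← ofReal_integral_eq_lintegral_ofReal (hB.integrable (n + 1) x).restrict
          (.of_forall fun ω => Nat.cast_nonneg _), hint,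
        ofReal_integral_eq_lintegral_ofReal hi.restrict (.of_forall h0)]
    _ = _ := by
      rw [← lintegral_const_mul' _ _ ENNReal.ofReal_ne_top]
      refine lintegral_congr fun ω => ?_
      rw [← ENNReal.ofReal_mul hr, ← mul_assoc,
        show (m ^ (n + 1))⁻¹ * m = (m ^ n)⁻¹ by rw [pow_succ]; field_simp, ← tsum_mul_left,
        ENNReal.ofReal_tsum_of_nonneg
          (fun y => mul_nonneg (by positivity) (mul_nonneg (Nat.cast_nonneg _) (hP _ _)))
          ((hsum ω).mul_left _)]
      refine tsum_congr fun y => ?_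
      rw [← mul_assoc, ENNReal.ofReal_mul (by positivity)]

variable [Countable S]

protected lemma measurable_brwPairing (hB : IsBranchingRandomWalk P m o μ F B)
    (g : S → ℝ≥0∞) (n : ℕ) : Measurable[F n] (brwPairing m B g n) := by
  let _ : MeasurableSpace Ω := F n
  exact _root_.measurable_brwPairing m g (hB.adapted n)

lemma measurable_brwPairing' (hB : IsBranchingRandomWalk P m o μ F B) (g : S → ℝ≥0∞) (n : ℕ) :
    Measurable (brwPairing m B g n) :=
  (hB.measurable_brwPairing g n).mono (F.le n) le_rfl

variable [IsProbabilityMeasure μ]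

lemma setLIntegral_brwPairing_succ (hB : IsBranchingRandomWalk P m o μ F B) (hm : 0 < m)
    (hP : ∀ x y, 0 ≤ P x y) (g : S → ℝ≥0∞) (n : ℕ) {T : Set Ω} (hT : MeasurableSet[F n] T) :
    ∫⁻ ω in T, brwPairing m B g (n + 1) ω ∂μ =
      ∫⁻ ω in T, brwPairing m B (fun y => ∑' x, ENNReal.ofReal (P y x) * g x) n ω ∂μ := by
  have hmeas : ∀ n x, Measurable fun ω => ENNReal.ofReal ((m ^ n)⁻¹ * (B n ω x : ℝ)) :=
    fun n x => ENNReal.measurable_ofReal.comp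
      (((measurable_of_countable (fun k : ℕ => (k : ℝ))).comp
        ((hB.adapted n x).mono (F.le _) le_rfl)).const_mul _)
  have hmeas' : ∀ x, Measurable fun ω => ∑' y, ENNReal.ofReal ((m ^ n)⁻¹ * (B n ω y : ℝ)) *
      ENNReal.ofReal (P y x) :=
    fun x => Measurable.tsum fun y => (hmeas n y).mul_const _
  simp only [brwPairing]
  rw [lintegral_tsum fun x => ((hmeas (n + 1) x).mul_const _).aemeasurable]
  simp_rw [lintegral_mul_const _ (hmeas (n + 1) _), hB.setLIntegral_weight_succ hm hP n _ hT,
    ← lintegral_mul_const _ (hmeas' _)]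
  rw [← lintegral_tsum fun x => ((hmeas' x).mul_const _).aemeasurable]
  refine lintegral_congr fun ω => ?_
  simp_rw [← ENNReal.tsum_mul_right, ← ENNReal.tsum_mul_left]
  rw [ENNReal.tsum_comm]
  simp only [mul_assoc]

lemma lintegral_brwPairing_le (hB : IsBranchingRandomWalk P m o μ F B) (hm : 0 < m)
    (hP : ∀ x y, 0 ≤ P x y) {g : S → ℝ≥0∞}
    (hg : ∀ x, ∑' y, ENNReal.ofReal (P x y) * g y ≤ g x) (n : ℕ) :
    ∫⁻ ω, brwPairing m B g n ω ∂μ ≤ g o := by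
  induction n with
  | zero => simp [hB.brwPairing_zero]
  | succ n ih =>
    have := hB.setLIntegral_brwPairing_succ hm hP g n MeasurableSet.univ
    rw [Measure.restrict_univ] at this
    rw [this]
    exact (lintegral_mono fun ω => brwPairing_mono m B hg n ω).trans ih

/-- Pairings with bounded superharmonic functions converge almost surely. -/
lemma ae_exists_tendsto_brwPairing (hB : IsBranchingRandomWalk P m o μ F B) (hm : 0 < m)
    (hP : ∀ x y, 0 ≤ P x y) {g : S → ℝ≥0∞} (hg1 : ∀ x, g x ≤ 1)
    (hg : ∀ x, ∑' y, ENNReal.ofReal (P x y) * g y ≤ g x) :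
    ∀ᵐ ω ∂μ, ∃ L : ℝ≥0∞, L ≠ ∞ ∧
      Tendsto (fun n => brwPairing m B g n ω) atTop (𝓝 L) := by
  have hfin := hB.brwPairing_ne_top hg1
  have hmeas := hB.measurable_brwPairing' g
  have hle : ∀ n, ∫⁻ ω, brwPairing m B g n ω ∂μ ≤ 1 := fun n =>
    (hB.lintegral_brwPairing_le hm hP hg n).trans (hg1 o)
  have hint : ∀ n, Integrable (fun ω => (brwPairing m B g n ω).toReal) μ := fun n =>
    integrable_toReal_of_lintegral_ne_top (hmeas n).aemeasurable
      ((hle n).trans_lt ENNReal.one_lt_top).ne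
  have hset : ∀ n (T : Set Ω), ∫⁻ ω in T, brwPairing m B g n ω ∂μ ≠ ∞ := fun n T =>
    (((setLIntegral_le_lintegral T _).trans (hle n)).trans_lt ENNReal.one_lt_top).ne
  have hsuper : Supermartingale (fun n ω => (brwPairing m B g n ω).toReal) F μ := by
    refine supermartingale_of_setIntegral_succ_le
      (fun n => (hB.measurable_brwPairing g n).ennreal_toReal.stronglyMeasurable) hint
      fun n T hT => ?_
    rw [integral_toReal (hmeas _).aemeasurable (.of_forall fun ω => (hfin _ ω).lt_top),
      integral_toReal (hmeas _).aemeasurable (.of_forall fun ω => (hfin _ ω).lt_top)]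
    refine ENNReal.toReal_mono (hset n T) ?_
    rw [hB.setLIntegral_brwPairing_succ hm hP g n hT]
    exact lintegral_mono fun ω => brwPairing_mono m B hg n ω
  have hbdd : ∀ n, eLpNorm ((-fun n ω => (brwPairing m B g n ω).toReal) n) 1 μ ≤ (1 : NNReal) := by
    intro n
    rw [Pi.neg_apply, eLpNorm_neg, eLpNorm_one_eq_lintegral_enorm]
    refine le_trans (lintegral_mono fun ω => ?_) (hle n)
    rw [Real.enorm_eq_ofReal ENNReal.toReal_nonneg, ENNReal.ofReal_toReal (hfin n ω)]
  filter_upwards [hsuper.neg.ae_tendsto_limitProcess hbdd] with ω hω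
  have h2 := ENNReal.tendsto_ofReal hω.neg
  refine ⟨_, ENNReal.ofReal_ne_top, h2.congr fun n => ?_⟩
  simp [ENNReal.ofReal_toReal (hfin n ω)]

lemma ae_tendsto_brwPairing_zero (hB : IsBranchingRandomWalk P m o μ F B) (hm : 0 < m)
    (hP : ∀ x y, 0 ≤ P x y) {g : S → ℝ≥0∞} (hg1 : ∀ x, g x ≤ 1)
    (hg : ∀ x, ∑' y, ENNReal.ofReal (P x y) * g y ≤ g x)
    (h0 : Tendsto (fun n => ∫⁻ ω, brwPairing m B g n ω ∂μ) atTop (𝓝 0)) :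
    ∀ᵐ ω ∂μ, Tendsto (fun n => brwPairing m B g n ω) atTop (𝓝 0) := by
  have hmeas := hB.measurable_brwPairing' g
  have hF : ∫⁻ ω, liminf (fun n => brwPairing m B g n ω) atTop ∂μ = 0 :=
    le_antisymm ((lintegral_liminf_le hmeas).trans h0.liminf_eq.le) zero_le
  rw [lintegral_eq_zero_iff (Measurable.liminf hmeas)] at hF
  filter_upwards [hF, hB.ae_exists_tendsto_brwPairing hm hP hg1 hg] with ω h1 h2
  obtain ⟨L, -, hL⟩ := h2
  rwa [← hL.liminf_eq, show liminf (fun n => brwPairing m B g n ω) atTop = 0 from h1] at hL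

variable [MeasurableSpace S] [MeasurableSingletonClass S] {Q : S → Measure (ℕ → S)}

lemma lintegral_brwPairing_lintegral (hB : IsBranchingRandomWalk P m o μ F B) (hm : 0 < m)
    (hP : ∀ x y, 0 ≤ P x y)
    (hQ : IsMarkovChainLaw (fun x y => ENNReal.ofReal (P x y)) Q) (n : ℕ)
    {G : (ℕ → S) → ℝ≥0∞} (hG : Measurable G) :
    ∫⁻ ω, brwPairing m B (fun x => ∫⁻ η, G η ∂Q x) n ω ∂μ = ∫⁻ η, G (pathShift n η) ∂Q o := by
  induction n generalizing G with
  | zero =>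
    simp only [hB.brwPairing_zero, lintegral_const, measure_univ, mul_one]
    refine lintegral_congr fun η => ?_
    congr 1
    ext i
    simp [pathShift]
  | succ n ih =>
    have := hB.setLIntegral_brwPairing_succ hm hP (fun x => ∫⁻ η, G η ∂Q x) n MeasurableSet.univ
    rw [Measure.restrict_univ] at this
    rw [this]
    simp only [hQ.tsum_mul_lintegral _ hG]
    rw [ih (G := fun η => G (pathShift 1 η)) (hG.comp (measurable_pathShift 1))]
    refine lintegral_congr fun η => ?_
    congr 1
    ext i
    simp [pathShift, add_assoc]

/-- If `d` vanishes asymptotically along the chain, then its pairing with the rescaled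
branching random walk tends to zero almost surely. -/
lemma ae_tendsto_brwPairing_zero_of_chain (hB : IsBranchingRandomWalk P m o μ F B) (hm : 0 < m)
    (hP : ∀ x y, 0 ≤ P x y) (hQ : IsMarkovChainLaw (fun x y => ENNReal.ofReal (P x y)) Q)
    {d : S → ℝ≥0∞} (hd1 : ∀ x, d x ≤ 1)
    (hd : ∀ᵐ η ∂Q o, Tendsto (fun n => d (η n)) atTop (𝓝 0)) :
    ∀ᵐ ω ∂μ, Tendsto (fun n => brwPairing m B d n ω) atTop (𝓝 0) := by
  have := hQ.isProbabilityMeasure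
  have hdm : Measurable d := measurable_of_countable d
  have hsup : Measurable fun η : ℕ → S => ⨆ k, d (η k) :=
    Measurable.iSup fun k => hdm.comp (measurable_pi_apply k)
  have hsup1 : ∀ η : ℕ → S, ⨆ k, d (η k) ≤ 1 := fun η => iSup_le fun k => hd1 _
  have hle : ∀ x, d x ≤ ∫⁻ η, ⨆ k, d (η k) ∂Q x := by
    intro x
    calc d x = ∫⁻ _, d x ∂Q x := by simp
      _ ≤ _ := lintegral_mono_ae <| by
        filter_upwards [hQ.ae_zero x] with η hη
        exact (congrArg d hη.symm).le.trans (le_iSup (fun k => d (η k)) 0)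
  have hD : ∀ᵐ ω ∂μ, Tendsto (fun n => brwPairing m B (fun x => ∫⁻ η, ⨆ k, d (η k) ∂Q x) n ω)
      atTop (𝓝 0) := by
    refine hB.ae_tendsto_brwPairing_zero hm hP (fun x => ?_) (fun x => ?_) ?_
    · exact (lintegral_mono hsup1).trans (by simp)
    · rw [hQ.tsum_mul_lintegral x hsup]
      exact lintegral_mono fun η => iSup_le fun k => le_iSup (fun k => d (η k)) (1 + k)
    · simp only [hB.lintegral_brwPairing_lintegral hm hP hQ _ hsup]
      rw [← lintegral_zero (μ := Q o)]
      refine tendsto_lintegral_of_dominated_convergence (fun _ => 1)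
        (fun n => hsup.comp (measurable_pathShift n)) (fun n => .of_forall fun η => hsup1 _)
        (by simp) ?_
      filter_upwards [hd] with η hη
      rw [ENNReal.tendsto_nhds_zero] at hη ⊢
      intro ε hε
      obtain ⟨N, hN⟩ := eventually_atTop.1 (hη ε hε)
      filter_upwards [eventually_ge_atTop N] with n hn
      exact iSup_le fun k => hN (n + k) (by omega)
  filter_upwards [hD] with ω hω
  exact tendsto_of_tendsto_of_tendsto_of_le_of_le tendsto_const_nhds hω (fun _ => zero_le)
    fun n => brwPairing_mono m B hle n ω

end IsBranchingRandomWalk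

namespace IsMarkovChainLaw

variable {S C : Type*} [MeasurableSpace S] [Countable S] [MeasurableSingletonClass S]
  {p : S → S → ℝ≥0∞} {Q : S → Measure (ℕ → S)} [TopologicalSpace C] [T2Space C]
  {ι : S → C} {Xinf : (ℕ → S) → C}

lemma ae_limit_pathShift (hQ : IsMarkovChainLaw p Q)
    (hX : ∀ x, ∀ᵐ η ∂Q x, Tendsto (fun n => ι (η n)) atTop (𝓝 (Xinf η))) (x : S) (n : ℕ) :
    ∀ᵐ η ∂Q x, Xinf (pathShift n η) = Xinf η := by
  filter_upwards [hX x, hQ.ae_comp_pathShift hX x n] with η h1 h2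
  refine tendsto_nhds_unique h2 ?_
  simpa [pathShift, add_comm] using (tendsto_add_atTop_iff_nat n).2 h1

variable [MeasurableSpace C]

/-- Functions of the limit point have harmonic expectations. -/
lemma tsum_mul_lintegral_limit (hQ : IsMarkovChainLaw p Q) (hXm : Measurable Xinf)
    (hX : ∀ x, ∀ᵐ η ∂Q x, Tendsto (fun n => ι (η n)) atTop (𝓝 (Xinf η)))
    {f : C → ℝ≥0∞} (hf : Measurable f) (x : S) :
    ∑' y, p x y * ∫⁻ η, f (Xinf η) ∂Q y = ∫⁻ η, f (Xinf η) ∂Q x := by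
  rw [hQ.tsum_mul_lintegral x (G := fun η => f (Xinf η)) (hf.comp hXm)]
  refine lintegral_congr_ae ?_
  filter_upwards [hQ.ae_limit_pathShift hX x 1] with η hη
  simp [hη]

end IsMarkovChainLaw

lemma IsBranchingRandomWalk.ae_tendsto_brwPairing_continuous {S Ω C : Type*} [DecidableEq S]
    [Countable S] [MeasurableSpace S] [MeasurableSingletonClass S] {mΩ : MeasurableSpace Ω}
    [TopologicalSpace C] [T2Space C] [MeasurableSpace C] [OpensMeasurableSpace C]
    {P : S → S → ℝ} {m : ℝ} {o : S} {μ : Measure Ω} [IsProbabilityMeasure μ]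
    {F : Filtration ℕ mΩ} {B : ℕ → Ω → S → ℕ} {Q : S → Measure (ℕ → S)}
    {ι : S → C} {Xinf : (ℕ → S) → C}
    (hB : IsBranchingRandomWalk P m o μ F B) (hm : 0 < m)
    (hP : ∀ x y, 0 ≤ P x y) (hQ : IsMarkovChainLaw (fun x y => ENNReal.ofReal (P x y)) Q)
    (hXm : Measurable Xinf)
    (hX : ∀ x, ∀ᵐ η ∂Q x, Tendsto (fun n => ι (η n)) atTop (𝓝 (Xinf η)))
    {f : C → ℝ≥0∞} (hf : Continuous f) (hf1 : ∀ c, f c ≤ 1) :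
    ∀ᵐ ω ∂μ, ∃ L : ℝ≥0∞, L ≠ ∞ ∧
      Tendsto (fun n => brwPairing m B (fun x => f (ι x)) n ω) atTop (𝓝 L) ∧
      Tendsto (fun n => brwPairing m B (fun x => ∫⁻ η, f (Xinf η) ∂Q x) n ω) atTop (𝓝 L) := by
  have := hQ.isProbabilityMeasure
  set u : S → ℝ≥0∞ := fun x => ∫⁻ η, f (Xinf η) ∂Q x with hu
  have hu1 : ∀ x, u x ≤ 1 := fun x => (lintegral_mono fun η => hf1 _).trans (by simp)
  set d : S → ℝ≥0∞ := fun x => max (f (ι x) - u x) (u x - f (ι x)) with hd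
  have hd0 : ∀ᵐ η ∂Q o, Tendsto (fun n => d (η n)) atTop (𝓝 0) := by
    filter_upwards [hX o, hQ.tendsto_lintegral_of_shift_invariant
      (G := fun η => f (Xinf η)) (hf.measurable.comp hXm) (fun η => hf1 _)
      (fun x n => (hQ.ae_limit_pathShift hX x n).mono fun η hη => congrArg f hη) o] with η h1 h2
    have h3 : Tendsto (fun n => f (ι (η n))) atTop (𝓝 (f (Xinf η))) :=
      (hf.tendsto _).comp h1
    have h4 : Tendsto (fun n => u (η n)) atTop (𝓝 (f (Xinf η))) := h2
    have hne : f (Xinf η) ≠ ∞ := ((hf1 _).trans_lt ENNReal.one_lt_top).ne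
    have := (ENNReal.Tendsto.sub h3 h4 (.inl hne)).max (ENNReal.Tendsto.sub h4 h3 (.inl hne))
    simpa [hd] using this
  have hd1 : ∀ x, d x ≤ 1 := fun x =>
    max_le (tsub_le_self.trans (hf1 _)) (tsub_le_self.trans (hu1 _))
  have huh : ∀ x, ∑' y, ENNReal.ofReal (P x y) * u y ≤ u x := fun x =>
    (hQ.tsum_mul_lintegral_limit hXm hX hf.measurable x).le
  have hfu : ∀ x, f (ι x) ≤ u x + d x := fun x => tsub_le_iff_left.1 (le_max_left _ _)
  have huf : ∀ x, u x ≤ f (ι x) + d x := fun x => tsub_le_iff_left.1 (le_max_right _ _)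
  clear_value u d
  filter_upwards [hB.ae_tendsto_brwPairing_zero_of_chain hm hP hQ hd1 hd0,
    hB.ae_exists_tendsto_brwPairing hm hP hu1 huh] with ω h1 ⟨L, hL, h2⟩
  refine ⟨L, hL, ?_, h2⟩
  have hlow := ENNReal.Tendsto.sub h2 h1 (.inl hL)
  have hupp := h2.add h1
  rw [tsub_zero] at hlow
  rw [add_zero] at hupp
  refine tendsto_of_tendsto_of_tendsto_of_le_of_le hlow hupp (fun n => ?_) fun n => ?_
  · refine tsub_le_iff_right.2 ?_
    rw [← brwPairing_add]
    exact brwPairing_mono m B huf n ω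
  · dsimp only
    rw [← brwPairing_add]
    exact brwPairing_mono m B hfu n ω

lemma lintegral_brwMeasure {S C : Type*} [MeasurableSpace C] (ι : S → C) (w : S → ℝ≥0∞)
    {f : C → ℝ≥0∞} (hf : Measurable f) :
    ∫⁻ c, f c ∂brwMeasure ι w = ∑' x, w x * f (ι x) := by
  simp [brwMeasure, lintegral_sum_measure, lintegral_smul_measure, lintegral_dirac' _ hf]

lemma IsSubseqWeakLimit.lintegral_eq {C : Type*} [TopologicalSpace C] [MeasurableSpace C]
    [OpensMeasurableSpace C] {μs : ℕ → Measure C} {W : Measure C} [IsFiniteMeasure W]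
    (h : IsSubseqWeakLimit μs W) (f : BoundedContinuousFunction C NNReal) {L : ℝ≥0∞} (hL : L ≠ ∞)
    (hf : Tendsto (fun n => ∫⁻ c, f c ∂μs n) atTop (𝓝 L)) : ∫⁻ c, f c ∂W = L := by
  obtain ⟨φ, hφ, hlim⟩ := h
  have hreal : ∀ ν : Measure C, ∫ c, (f c : ℝ) ∂ν = (∫⁻ c, f c ∂ν).toReal := by
    intro ν
    rw [integral_eq_lintegral_of_nonneg_ae (.of_forall fun c => NNReal.coe_nonneg _)
      (NNReal.continuous_coe.comp f.continuous).aestronglyMeasurable]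
    simp
  have h1 : Tendsto (fun k => (∫⁻ c, f c ∂μs (φ k)).toReal) atTop
      (𝓝 (∫⁻ c, f c ∂W).toReal) := by
    have := hlim (BoundedContinuousFunction.ofNormedAddCommGroup (fun c => (f c : ℝ))
      (by fun_prop) (nndist f 0) fun c => by
        simpa [NNReal.dist_eq] using f.dist_coe_le_dist (g := 0) c)
    simpa [hreal] using this
  have h2 := (ENNReal.tendsto_toReal hL).comp (hf.comp hφ.tendsto_atTop)
  exact (ENNReal.toReal_eq_toReal_iff' (f.lintegral_lt_top_of_nnreal W).ne hL).1
    (tendsto_nhds_unique h1 h2)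

/-- Let `A ⊆ ∂` be closed in the subspace topology of `∂` and
`h(x) := 𝐏ₓ(X_∞ ∈ A)`. Almost surely the limit `limₙ ⟨h, B̄ₙ⟩` exists, and every
subsequential weak limit `W` of the random measures `B̄ₙ` on `C` satisfies
`W(A) = limₙ ⟨h, B̄ₙ⟩`. -/
theorem brw_relatively_closed_set_mass
    {S : Type*} [Countable S] [DecidableEq S]
    (P : S → S → ℝ)
    (hP0 : ∀ x y, 0 ≤ P x y)
    (hP1 : ∀ x, HasSum (fun y => P x y) 1)
    (m : ℝ) (hm : 1 < m) (o : S)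
    {Ω : Type*} {mΩ : MeasurableSpace Ω}
    (μ : Measure Ω) [IsProbabilityMeasure μ]
    (F : Filtration ℕ mΩ)
    (B : ℕ → Ω → S → ℕ)
    (hadapt : ∀ n x, Measurable[F n] (fun ω => B n ω x))
    (hfin : ∀ n ω, (Function.support (B n ω)).Finite)
    (hint : ∀ n x, Integrable (fun ω => (B n ω x : ℝ)) μ)
    (hB0 : ∀ ω x, B 0 ω x = if x = o then 1 else 0)
    (hbranch : ∀ n x,
      μ[fun ω => (B (n + 1) ω x : ℝ)|F n]
        =ᵐ[μ] fun ω => m * ∑' y, (B n ω y : ℝ) * P y x)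
    {C : Type*} [TopologicalSpace C] [CompactSpace C]
    [TopologicalSpace.MetrizableSpace C] [MeasurableSpace C] [BorelSpace C]
    [TopologicalSpace S] [DiscreteTopology S]
    (ι : S → C) (hι : IsOpenEmbedding ι)
    [MeasurableSpace S] [MeasurableSingletonClass S]
    (Q : S → Measure (ℕ → S))
    (hQprob : ∀ x, IsProbabilityMeasure (Q x))
    (hQcyl : ∀ (x : S) (n : ℕ) (s : ℕ → S),
      Q x {ω | ∀ i ≤ n, ω i = s i} =
        (if s 0 = x then 1 else 0) *
          ∏ i ∈ Finset.range n, ENNReal.ofReal (P (s i) (s (i + 1))))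
    (Xinf : (ℕ → S) → C)
    (hXmeas : Measurable Xinf)
    (hXconv : ∀ x : S, ∀ᵐ ω ∂(Q x),
      Xinf ω ∈ (Set.range ι)ᶜ ∧ Tendsto (fun n => ι (ω n)) atTop (𝓝 (Xinf ω)))
    (A : Set C) (hAsub : A ⊆ (Set.range ι)ᶜ)
    (hAclosed : ∃ V : Set C, IsClosed V ∧ A = V ∩ (Set.range ι)ᶜ) :
    ∀ᵐ ω ∂μ, ∃ L : ℝ,
      Tendsto (fun n => (m ^ n)⁻¹ * ∑' x, (Q x (Xinf ⁻¹' A)).toReal * (B n ω x : ℝ))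
        atTop (𝓝 L) ∧
      ∀ W : Measure C, IsFiniteMeasure W →
        IsSubseqWeakLimit
          (fun n => brwMeasure ι fun x => ENNReal.ofReal ((m ^ n)⁻¹ * (B n ω x : ℝ))) W →
        W A = ENNReal.ofReal L := by
  have hm0 : 0 < m := zero_lt_one.trans hm
  have hB : IsBranchingRandomWalk P m o μ F B := ⟨hadapt, hfin, hint, hB0, hbranch⟩
  have hQ : IsMarkovChainLaw (fun x y => ENNReal.ofReal (P x y)) Q :=
    ⟨hQprob, fun n s => by simpa [pathCylinder] using hQcyl (s 0) n s,
      fun x n s h => by simpa [pathCylinder, h] using hQcyl x n s⟩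
  have hX : ∀ x, ∀ᵐ η ∂Q x, Tendsto (fun n => ι (η n)) atTop (𝓝 (Xinf η)) :=
    fun x => (hXconv x).mono fun η h => h.2
  have hA : IsClosed A := by
    obtain ⟨V, hV, rfl⟩ := hAclosed
    exact hV.inter hι.isOpen_range.isClosed_compl
  let f : ℕ → C → ℝ≥0∞ := fun k c => hA.apprSeq k c
  let χ : C → ℝ≥0∞ := A.indicator fun _ => 1
  have hfc : ∀ k, Continuous (f k) := fun k =>
    ENNReal.continuous_coe.comp (hA.apprSeq k).continuous
  have hf1 : ∀ k c, f k c ≤ 1 := fun k c =>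
    ENNReal.coe_le_one_iff.2 (HasOuterApproxClosed.apprSeq_apply_le_one hA k c)
  have hχm : Measurable χ := measurable_const.indicator hA.measurableSet
  have hχf : ∀ k c, χ c ≤ f k c := by
    intro k c
    by_cases hc : c ∈ A
    · simp [χ, f, hc, HasOuterApproxClosed.apprSeq_apply_eq_one hA k hc]
    · simp [χ, hc]
  have hχ1 : ∀ c, χ c ≤ 1 := fun c => (hχf 0 c).trans (hf1 0 c)
  let h : S → ℝ≥0∞ := fun x => ∫⁻ η, χ (Xinf η) ∂Q x
  let v : ℕ → S → ℝ≥0∞ := fun k x => ∫⁻ η, (f k (Xinf η) - χ (Xinf η)) ∂Q x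
  have hh : ∀ x, h x = Q x (Xinf ⁻¹' A) := fun x => by
    rw [← lintegral_indicator_one (hXmeas hA.measurableSet)]
    rfl
  have hh1 : ∀ x, h x ≤ 1 := fun x => by rw [hh]; exact prob_le_one
  have hv1 : ∀ k x, v k x ≤ 1 := fun k x =>
    (lintegral_mono fun η => tsub_le_self.trans (hf1 k _)).trans (by simp)
  have hfχm : ∀ k, Measurable fun c => f k c - χ c := fun k => (hfc k).measurable.sub hχm
  have hhh : ∀ x, ∑' y, ENNReal.ofReal (P x y) * h y ≤ h x := fun x =>
    (hQ.tsum_mul_lintegral_limit hXmeas hX hχm x).le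
  have hvh : ∀ k x, ∑' y, ENNReal.ofReal (P x y) * v k y ≤ v k x := fun k x =>
    (hQ.tsum_mul_lintegral_limit hXmeas hX (hfχm k) x).le
  have hsplit : ∀ k, (fun x => ∫⁻ η, f k (Xinf η) ∂Q x) = fun x => h x + v k x := by
    intro k
    ext x
    refine Eq.trans ?_ (lintegral_add_left (hχm.comp hXmeas) _)
    exact lintegral_congr fun η => (add_tsub_cancel_of_le (hχf k _)).symm
  have hv0 : Tendsto (fun k => v k o) atTop (𝓝 0) := by
    rw [← lintegral_zero (μ := Q o)]
    refine tendsto_lintegral_of_dominated_convergence (fun _ => 1)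
      (fun k => (hfχm k).comp hXmeas) (fun k => .of_forall fun η => tsub_le_self.trans (hf1 k _))
      (by simp) (.of_forall fun η => ?_)
    have h1 : Tendsto (fun k => f k (Xinf η)) atTop (𝓝 (χ (Xinf η))) := by
      have := (tendsto_pi_nhds.1 (HasOuterApproxClosed.tendsto_apprSeq hA)) (Xinf η)
      have heq : χ (Xinf η) = ((A.indicator (fun _ => (1 : NNReal)) (Xinf η) : NNReal) : ℝ≥0∞) := by
        by_cases hc : Xinf η ∈ A <;> simp [χ, hc]
      rw [heq]
      exact (ENNReal.continuous_coe.tendsto _).comp this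
    have hne : χ (Xinf η) ≠ ∞ := ((hχ1 _).trans_lt ENNReal.one_lt_top).ne
    have hsub := ENNReal.Tendsto.sub h1 (tendsto_const_nhds (x := χ (Xinf η))) (.inl hne)
    rwa [tsub_self] at hsub
  have hmeas : ∀ k, Measurable fun ω => liminf (fun n => brwPairing m B (v k) n ω) atTop :=
    fun k => Measurable.liminf (hB.measurable_brwPairing' (v k))
  have hlim0 : ∀ᵐ ω ∂μ,
      liminf (fun k => liminf (fun n => brwPairing m B (v k) n ω) atTop) atTop = 0 := by
    have hle : ∀ k, ∫⁻ ω, liminf (fun n => brwPairing m B (v k) n ω) atTop ∂μ ≤ v k o := by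
      intro k
      refine (lintegral_liminf_le (hB.measurable_brwPairing' (v k))).trans ?_
      refine (liminf_le_liminf (.of_forall fun n =>
        hB.lintegral_brwPairing_le hm0 hP0 (hvh k) n)).trans ?_
      simp
    have hF : ∫⁻ ω, liminf (fun k => liminf (fun n => brwPairing m B (v k) n ω) atTop) atTop ∂μ
        = 0 :=
      le_antisymm (((lintegral_liminf_le hmeas).trans
        (liminf_le_liminf (.of_forall hle))).trans hv0.liminf_eq.le) zero_le
    exact (lintegral_eq_zero_iff (Measurable.liminf hmeas)).1 hF
  filter_upwards [hlim0, hB.ae_exists_tendsto_brwPairing hm0 hP0 hh1 hhh,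
    ae_all_iff.2 fun k => hB.ae_exists_tendsto_brwPairing hm0 hP0 (hv1 k) (hvh k),
    ae_all_iff.2 fun k => hB.ae_tendsto_brwPairing_continuous hm0 hP0 hQ hXmeas hX
      (hfc k) (hf1 k)] with ω hω0 ⟨L, hL, hhL⟩ hvL hfL
  refine ⟨L.toReal, ?_, fun W hW hWlim => ?_⟩
  · refine ((ENNReal.tendsto_toReal hL).comp hhL).congr fun n => ?_
    simp only [Function.comp_apply, toReal_brwPairing hm0 B hh1, hh]
  rw [ENNReal.ofReal_toReal hL]
  choose l _ hl using hvL
  simp only [fun k => (hl k).liminf_eq] at hω0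
  have hWf : ∀ k, ∫⁻ c, f k c ∂W = L + l k := by
    intro k
    obtain ⟨L', hL', h1, h2⟩ := hfL k
    rw [hsplit k] at h2
    simp only [brwPairing_add] at h2
    rw [← tendsto_nhds_unique h2 (hhL.add (hl k))]
    refine hWlim.lintegral_eq (hA.apprSeq k) hL' ?_
    refine h1.congr fun n => ?_
    rw [lintegral_brwMeasure ι _ (hfc k).measurable]
    rfl
  have hWA : Tendsto (fun k => L + l k) atTop (𝓝 (W A)) :=
    (HasOuterApproxClosed.tendsto_lintegral_apprSeq hA W).congr hWf
  refine le_antisymm (tsub_eq_zero_iff_le.1 ?_) (ge_of_tendsto' hWA fun k => le_self_add)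
  have hsub := ENNReal.Tendsto.sub hWA (tendsto_const_nhds (x := L)) (.inr hL)
  simp only [ENNReal.add_sub_cancel_left hL] at hsub
  rw [← hsub.liminf_eq, hω0]
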